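/- arXiv:2206.10439 — 4 statements merged into one kernel-verified Lean document; each statement's English description precedes it below -/
import Mathlib

section
/- Let J ⊆ ℤ^n be a finite jump system and f a separable convex function. Let x ∈ J be a vector that is not an optimal solution of (JSC), and let s* ∈ U satisfy (descent-s) at x. Then there exists x* ∈ M*(x) such that x*(i) ≤ x(i) − 1 if s* = −χ_i, and x*(i) ≥ x(i) + 1 if s* = +χ_i. -/
open scoped BigOperators

def l1 {n : ℕ} (x : Fin n → ℤ) : ℤ := ∑ i, |x i|

def UnitVec (n : ℕ) : Set (Fin n → ℤ) :=
  {s | ∃ i : Fin n, s = Pi.single i 1 ∨ s = -Pi.single i 1}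

def inc {n : ℕ} (x y : Fin n → ℤ) : Set (Fin n → ℤ) :=
  {s | s ∈ UnitVec n ∧ l1 (x + s - y) = l1 (x - y) - 1}

def IsJumpSystem {n : ℕ} (J : Set (Fin n → ℤ)) : Prop :=
  J.Nonempty ∧ ∀ x ∈ J, ∀ y ∈ J, ∀ s ∈ inc x y,
    x + s ∉ J → ∃ t ∈ inc (x + s) y, x + s + t ∈ J

def IsSepConvex {n : ℕ} (f : (Fin n → ℤ) → ℝ) : Prop :=
  ∃ g : Fin n → ℤ → ℝ,
    (∀ i k, 2 * g i k ≤ g i (k - 1) + g i (k + 1)) ∧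
    ∀ x, f x = ∑ i, g i (x i)

def IsOptimal {n : ℕ} (J : Set (Fin n → ℤ)) (f : (Fin n → ℤ) → ℝ) (y : Fin n → ℤ) : Prop :=
  y ∈ J ∧ ∀ z ∈ J, f y ≤ f z

noncomputable def mu {n : ℕ} (J : Set (Fin n → ℤ)) (f : (Fin n → ℤ) → ℝ) (x : Fin n → ℤ) : ℤ :=
  sInf {d : ℤ | ∃ y, IsOptimal J f y ∧ d = l1 (y - x)}

def Mstar {n : ℕ} (J : Set (Fin n → ℤ)) (f : (Fin n → ℤ) → ℝ) (x : Fin n → ℤ) : Set (Fin n → ℤ) :=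
  {y | IsOptimal J f y ∧ l1 (y - x) = mu J f x}

def DescentS {n : ℕ} (J : Set (Fin n → ℤ)) (f : (Fin n → ℤ) → ℝ) (x s : Fin n → ℤ) : Prop :=
  s ∈ UnitVec n ∧
  (∃ t, (t ∈ UnitVec n ∨ t = 0) ∧ x + s + t ∈ J ∧ f (x + s + t) < f x) ∧
  ∀ s' ∈ UnitVec n,
    (∃ t, (t ∈ UnitVec n ∨ t = 0) ∧ x + s' + t ∈ J ∧ f (x + s' + t) < f x) →
    f (x + s) ≤ f (x + s')

def DescentT {n : ℕ} (J : Set (Fin n → ℤ)) (f : (Fin n → ℤ) → ℝ) (x s t : Fin n → ℤ) : Prop :=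
  (x + s ∈ J ∧ t = 0) ∨
  (x + s ∉ J ∧ t ∈ UnitVec n ∧ x + s + t ∈ J ∧
    ∀ t' ∈ UnitVec n, x + s + t' ∈ J → f (x + s + t) ≤ f (x + s + t'))

def Sset {n : ℕ} (x s t : Fin n → ℤ) : Set (Fin n → ℤ) :=
  {y | l1 (y - (x + s + t)) = l1 (y - x) - l1 (s + t)}

def CScase {n : ℕ} (x sstar : Fin n → ℤ) (h : Fin n) (xs ss : ℕ → Fin n → ℤ) (l : ℕ) : Prop :=
  xs (l - 1) h + ss l h = x h + sstar h ∧ ss l = Pi.single h 1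

def CTcase {n : ℕ} (x sstar : Fin n → ℤ) (h : Fin n) (xs ss ts : ℕ → Fin n → ℤ) (l : ℕ) : Prop :=
  xs (l - 1) h + ss l h = x h + sstar h - 1 ∧ ts l = Pi.single h 1

theorem l1_add_single {n : ℕ} (z : Fin n → ℤ) (i : Fin n) (e : ℤ) :
    l1 (z + Pi.single i e) = l1 z - |z i| + |z i + e| := by
  unfold l1
  rw [← Finset.add_sum_erase _ _ (Finset.mem_univ i),
    ← Finset.add_sum_erase _ (fun j => |z j|) (Finset.mem_univ i)]
  have h : ∑ j ∈ Finset.univ.erase i, |(z + Pi.single i e : Fin n → ℤ) j| =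
      ∑ j ∈ Finset.univ.erase i, |z j| :=
    Finset.sum_congr rfl fun j hj => by simp [Finset.ne_of_mem_erase hj]
  rw [h]
  simp only [Pi.add_apply, Pi.single_eq_same]
  ring

theorem sum_add_single {n : ℕ} (g : Fin n → ℤ → ℝ) (z : Fin n → ℤ) (i : Fin n) (e : ℤ) :
    ∑ j, g j ((z + Pi.single i e : Fin n → ℤ) j) = ∑ j, g j (z j) + (g i (z i + e) - g i (z i)) := by
  rw [← Finset.add_sum_erase _ _ (Finset.mem_univ i),
    ← Finset.add_sum_erase _ (fun j => g j (z j)) (Finset.mem_univ i)]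
  have h : ∑ j ∈ Finset.univ.erase i, g j ((z + Pi.single i e : Fin n → ℤ) j) =
      ∑ j ∈ Finset.univ.erase i, g j (z j) :=
    Finset.sum_congr rfl fun j hj => by simp [Finset.ne_of_mem_erase hj]
  rw [h]
  simp only [Pi.add_apply, Pi.single_eq_same]
  ring

theorem mem_unitVec_iff {n : ℕ} {s : Fin n → ℤ} :
    s ∈ UnitVec n ↔ ∃ i e, (e = 1 ∨ e = -1) ∧ s = Pi.single i e := by
  constructor
  · rintro ⟨i, h | h⟩
    · exact ⟨i, 1, .inl rfl, h⟩
    · exact ⟨i, -1, .inr rfl, by rw [h, Pi.single_neg]⟩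
  · rintro ⟨i, e, rfl | rfl, rfl⟩
    · exact ⟨i, .inl rfl⟩
    · exact ⟨i, .inr (by rw [Pi.single_neg])⟩

theorem single_mem_unitVec {n : ℕ} (i : Fin n) {e : ℤ} (he : e = 1 ∨ e = -1) :
    Pi.single i e ∈ UnitVec n :=
  mem_unitVec_iff.2 ⟨i, e, he, rfl⟩

theorem single_mem_inc_iff {n : ℕ} (x y : Fin n → ℤ) (i : Fin n) {e : ℤ} (he : e = 1 ∨ e = -1) :
    Pi.single i e ∈ inc x y ↔ 0 < e * (y i - x i) := by
  have h : x + Pi.single i e - y = (x - y) + Pi.single i e := by abel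
  simp only [inc, Set.mem_ofPred_eq, single_mem_unitVec i he, true_and, h, l1_add_single,
    Pi.sub_apply]
  rcases he with rfl | rfl <;> simp only [abs_eq_max_neg] <;> omega

theorem IsJumpSystem.exists_step {n : ℕ} {J : Set (Fin n → ℤ)} (hJ : IsJumpSystem J)
    {x y : Fin n → ℤ} (hx : x ∈ J) (hy : y ∈ J) {i : Fin n} {e : ℤ} (he : e = 1 ∨ e = -1)
    (h : 0 < e * (y i - x i)) :
    x + Pi.single i e ∈ J ∨ ∃ j d, (d = 1 ∨ d = -1) ∧
      0 < d * (y j - (x + Pi.single i e : Fin n → ℤ) j) ∧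
      x + Pi.single i e + Pi.single j d ∈ J := by
  by_cases hm : x + Pi.single i e ∈ J
  · exact .inl hm
  · obtain ⟨t, ht, htJ⟩ := hJ.2 x hx y hy _ ((single_mem_inc_iff x y i he).2 h) hm
    obtain ⟨j, d, hd, rfl⟩ := mem_unitVec_iff.1 ht.1
    exact .inr ⟨j, d, hd, (single_mem_inc_iff _ y j hd).1 ht, htJ⟩

theorem slope_mono {g : ℤ → ℝ} (hg : ∀ k, 2 * g k ≤ g (k - 1) + g (k + 1)) {e : ℤ}
    (he : e = 1 ∨ e = -1) {p q : ℤ} (h : e * p ≤ e * q) :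
    g (p + e) - g p ≤ g (q + e) - g q := by
  have mono : Monotone fun k : ℤ => g (k + 1) - g k := by
    refine monotone_int_of_le_succ fun k => ?_
    have := hg (k + 1)
    rw [add_sub_cancel_right] at this
    linarith
  rcases he with rfl | rfl
  · exact mono (by linarith)
  · have := mono (show q + -1 ≤ p + -1 by linarith)
    simp only [neg_add_cancel_right] at this
    linarith

/-- A step towards a strictly nearest minimiser which is steepest among all steps towards it, and
downhill, can be extended to a descent move inside the jump system. -/
theorem exists_descent_of_steepest {n : ℕ} {J : Set (Fin n → ℤ)} (hJ : IsJumpSystem J)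
    {f : (Fin n → ℤ) → ℝ} {g : Fin n → ℤ → ℝ}
    (hg : ∀ i k, 2 * g i k ≤ g i (k - 1) + g i (k + 1)) (hf : ∀ z, f z = ∑ i, g i (z i))
    {x w : Fin n → ℤ} (hx : x ∈ J) (hw : w ∈ J)
    (hnear : ∀ z ∈ J, l1 (z - x) < l1 (w - x) → f w < f z)
    {i : Fin n} {e : ℤ} (he : e = 1 ∨ e = -1) (hdir : 0 < e * (w i - x i))
    (hneg : g i (x i + e) - g i (x i) < 0)
    (hmin : ∀ j d, (d = 1 ∨ d = -1) → 0 < d * (w j - x j) →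
      g i (x i + e) - g i (x i) ≤ g j (x j + d) - g j (x j)) :
    ∃ t, (t ∈ UnitVec n ∨ t = 0) ∧ x + Pi.single i e + t ∈ J ∧
      f (x + Pi.single i e + t) < f x := by
  have hstep : ∀ z j d, f (z + Pi.single j d) = f z + (g j (z j + d) - g j (z j)) := by
    intro z j d
    rw [hf, hf, sum_add_single]
  by_contra! hno
  rcases hJ.exists_step hx hw he hdir with h | ⟨j, d, hd, hjd, h⟩
  · have := hno 0 (.inr rfl) (by simpa using h)
    rw [add_zero, hstep] at this
    linarith
  have hup := hno _ (.inl (single_mem_unitVec j hd)) h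
  rw [hstep, hstep] at hup
  set x₁ : Fin n → ℤ := x + Pi.single i e with hx₁
  have hx₁j : x₁ j = if j = i then x j + e else x j := by
    simp only [hx₁, Pi.add_apply, Pi.single_apply]; split_ifs <;> simp
  have hjx : 0 < d * (w j - x j) := by
    by_cases hji : j = i
    · subst hji
      rw [if_pos rfl] at hx₁j
      rcases he with rfl | rfl <;> rcases hd with rfl | rfl <;> omega
    · rw [if_neg hji] at hx₁j
      rwa [hx₁j] at hjd
  have hlast : g j (x₁ j + d) - g j (x₁ j) ≤ g j (w j) - g j (w j + -d) := by
    have := slope_mono (hg j) hd (p := x₁ j) (q := w j + -d)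
      (by rcases hd with rfl | rfl <;> linarith)
    simpa using this
  have hd' : -d = 1 ∨ -d = -1 := by omega
  have hdist : ∀ (z : Fin n → ℤ) k c, l1 (z + Pi.single k c - x) =
      l1 (z - x) - |z k - x k| + |z k - x k + c| := by
    intro z k c
    rw [add_sub_right_comm, l1_add_single]; rfl
  have hcloser : ∀ (z : Fin n → ℤ) k c, (c = 1 ∨ c = -1) → 0 < c * (x k - z k) →
      l1 (z + Pi.single k c - x) = l1 (z - x) - 1 := by
    intro z k c hc h
    rw [hdist]
    rcases hc with rfl | rfl <;> simp only [abs_eq_max_neg] <;> omega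
  have hwd : 0 < -d * (x j - w j) := by linarith
  rcases hJ.exists_step hw hx hd' hwd with h' | ⟨k, c, hc, hkc, h'⟩
  · have h1 := hnear _ h' (by rw [hcloser _ _ _ hd' hwd]; omega)
    rw [hstep] at h1
    linarith
  have h1 := hnear _ h' (by rw [hcloser _ _ _ hc hkc, hcloser _ _ _ hd' hwd]; omega)
  rw [hstep, hstep] at h1
  set w₁ : Fin n → ℤ := w + Pi.single j (-d) with hw₁
  have hw₁k : w₁ k = if k = j then w k + -d else w k := by
    simp only [hw₁, Pi.add_apply, Pi.single_apply]; split_ifs <;> simp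
  have hc' : -c = 1 ∨ -c = -1 := by omega
  have hkx : 0 < -c * (w k - x k) := by
    by_cases hkj : k = j
    · subst hkj
      rw [if_pos rfl] at hw₁k
      rcases hc with rfl | rfl <;> rcases hd with rfl | rfl <;> omega
    · rw [if_neg hkj] at hw₁k
      rw [hw₁k] at hkc
      linarith
  have h2 := hmin k (-c) hc' hkx
  have h3 := slope_mono (hg k) hc' (p := x k) (q := w₁ k + c)
    (by rcases hc with rfl | rfl <;> linarith)
  rw [add_neg_cancel_right] at h3
  linarith

theorem exists_mem_Mstar_of_descentS {n : ℕ} {J : Set (Fin n → ℤ)} {f : (Fin n → ℤ) → ℝ}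
    {x : Fin n → ℤ} (hJ : IsJumpSystem J) (hJfin : J.Finite) (hf : IsSepConvex f) (hxJ : x ∈ J)
    {h : Fin n} {e : ℤ} (he : e = 1 ∨ e = -1) (hs : DescentS J f x (Pi.single h e)) :
    ∃ y ∈ Mstar J f x, e * x h < e * y h := by
  obtain ⟨g, hg, hf⟩ := hf
  have hstep : ∀ z j d, f (z + Pi.single j d) = f z + (g j (z j + d) - g j (z j)) := by
    intro z j d
    rw [hf, hf, sum_add_single]
  have hdist : ∀ (z : Fin n → ℤ) k c, l1 (z + Pi.single k c - x) =
      l1 (z - x) - |z k - x k| + |z k - x k + c| := by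
    intro z k c
    rw [add_sub_right_comm, l1_add_single]; rfl
  have hbdd : BddBelow {d : ℤ | ∃ y, IsOptimal J f y ∧ d = l1 (y - x)} := by
    refine ⟨0, ?_⟩
    rintro _ ⟨y, -, rfl⟩
    exact Finset.sum_nonneg fun i _ => abs_nonneg _
  have hmu : ∀ y, IsOptimal J f y → mu J f x ≤ l1 (y - x) := fun y hy =>
    csInf_le hbdd ⟨y, hy, rfl⟩
  have hMfin : (Mstar J f x).Finite := hJfin.subset fun y hy => hy.1.1
  have hMne : (Mstar J f x).Nonempty := by
    obtain ⟨y, hyJ, hy⟩ := Set.exists_min_image J f hJfin hJ.1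
    obtain ⟨z, hz, hzd⟩ := Int.csInf_mem (s := {d : ℤ | ∃ y, IsOptimal J f y ∧ d = l1 (y - x)})
      ⟨_, y, ⟨hyJ, hy⟩, rfl⟩ hbdd
    exact ⟨z, hz, hzd.symm⟩
  obtain ⟨w, hwM, hwmax⟩ := Set.exists_max_image _ (fun y => e * y h) hMfin hMne
  by_contra! hno
  have hwx := hno w hwM
  obtain ⟨⟨hwJ, hwopt⟩, hwd⟩ := hwM
  have hnear : ∀ z ∈ J, l1 (z - x) < l1 (w - x) → f w < f z := by
    intro z hz hlt
    by_contra! hle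
    have := hmu z ⟨hz, fun v hv => hle.trans (hwopt v hv)⟩
    omega
  have hstrict : ∀ z ∈ J, l1 (z - x) ≤ l1 (w - x) → e * w h < e * z h → f w < f z := by
    intro z hz hd hlt
    by_contra! hle
    have hzo : IsOptimal J f z := ⟨hz, fun v hv => hle.trans (hwopt v hv)⟩
    have := hmu z hzo
    have := hwmax z ⟨hzo, by omega⟩
    omega
  obtain ⟨-, ⟨t, ht, hyJ, hyf⟩, hsmin⟩ := hs
  obtain ⟨k, c, rfl, hc⟩ : ∃ (k : Fin n) (c : ℤ), t = Pi.single k c ∧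
      (c = 1 ∨ c = -1 ∨ c = 0) := by
    rcases ht with ht | rfl
    · obtain ⟨k, c, hc, rfl⟩ := mem_unitVec_iff.1 ht
      exact ⟨k, c, rfl, by tauto⟩
    · exact ⟨h, 0, by simp, by simp⟩
  set y : Fin n → ℤ := x + Pi.single h e + Pi.single k c with hy
  have hyv : ∀ j, y j = x j + (if j = h then e else 0) + (if j = k then c else 0) := by
    intro j
    simp only [hy, Pi.add_apply, Pi.single_apply]
  have hyf' := hyf
  rw [hy, hstep, hstep] at hyf'
  simp only [Pi.add_apply, Pi.single_apply] at hyf'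
  have hback : ¬ (k = h ∧ c = -e) := by
    rintro ⟨rfl, rfl⟩
    simp at hyf'
    linarith
  have hβ : g h (x h + e) - g h (x h) < 0 := by
    by_cases hkh : k = h
    · subst hkh
      simp only [if_true] at hyf'
      rcases eq_or_ne c 0 with rfl | hc0
      · simp only [add_zero] at hyf'
        linarith
      · obtain rfl : c = e := by
          have : c ≠ -e := fun h => hback ⟨rfl, h⟩
          omega
        have := slope_mono (hg k) he (p := x k) (q := x k + c)
          (by rcases he with rfl | rfl <;> omega)
        linarith
    · simp only [if_neg hkh, add_zero] at hyf'
      rcases eq_or_ne c 0 with rfl | hc0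
      · simp only [add_zero] at hyf'
        linarith
      · have hcu : c = 1 ∨ c = -1 := by tauto
        have hxy : x + Pi.single k c + Pi.single h e = y := by rw [hy]; abel
        have := hsmin _ (single_mem_unitVec k hcu)
          ⟨_, .inl (single_mem_unitVec h he), hxy ▸ hyJ, hxy ▸ hyf⟩
        rw [hstep, hstep] at this
        linarith
  have hyh : e * x h + 1 ≤ e * y h := by
    rw [hyv, if_pos rfl]
    by_cases hkh : k = h
    · subst hkh
      have : c ≠ -e := fun h => hback ⟨rfl, h⟩
      rw [if_pos rfl]
      rcases he with rfl | rfl <;> omega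
    · rw [if_neg (Ne.symm hkh)]
      rcases he with rfl | rfl <;> omega
  have hwβ := slope_mono (hg h) he hwx
  have hdir : 0 < e * (y h - w h) := by linarith
  rcases hJ.exists_step hwJ hyJ he hdir with hz | ⟨j, d, hd, hjd, hz⟩
  · have := hwopt _ hz
    rw [hstep] at this
    linarith
  have hge := hwopt _ hz
  rw [hstep, hstep] at hge
  simp only [Pi.add_apply, Pi.single_apply] at hge hjd
  by_cases hjh : j = h
  · subst hjh
    simp only [if_true] at hge hjd
    obtain rfl : d = e := by
      rcases he with rfl | rfl <;> rcases hd with rfl | rfl <;> omega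
    by_cases hlt : d * (w j + d) ≤ d * x j
    · have := slope_mono (hg j) he hlt
      linarith
    · have hwj : w j = x j := by rcases he with rfl | rfl <;> omega
      have hyj := hyv j
      rw [if_pos rfl] at hyj
      have hkc : k = j ∧ c = d := by
        split_ifs at hyj with hjk
        · exact ⟨hjk.symm, by rcases he with rfl | rfl <;> omega⟩
        · rcases he with rfl | rfl <;> omega
      obtain ⟨rfl, rfl⟩ := hkc
      simp only [if_true] at hyf'
      rw [hwj] at hge
      linarith
  simp only [if_neg hjh, add_zero] at hge hjd
  have hjx : 0 < d * (x j - w j) := by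
    by_contra! hle
    have hyj := hyv j
    rw [if_neg hjh, add_zero] at hyj
    have hkc : k = j ∧ c = d ∧ w j = x j := by
      split_ifs at hyj with hjk
      · exact ⟨hjk.symm, by rcases hd with rfl | rfl <;> omega,
          by rcases hd with rfl | rfl <;> omega⟩
      · rcases hd with rfl | rfl <;> omega
    obtain ⟨rfl, rfl, hwk⟩ := hkc
    simp only [if_neg hjh, add_zero] at hyf'
    rw [hwk] at hge
    linarith
  have hlt := hstrict _ hz
    (by
      rw [hdist, hdist]
      simp only [Pi.add_apply, Pi.single_apply, if_neg hjh]
      rcases he with rfl | rfl <;> rcases hd with rfl | rfl <;>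
        simp only [abs_eq_max_neg] <;> omega)
    (by
      simp only [Pi.add_apply, Pi.single_apply, if_neg (Ne.symm hjh), if_true]
      rcases he with rfl | rfl <;> omega)
  rw [hstep, hstep] at hlt
  simp only [Pi.add_apply, Pi.single_apply, if_neg hjh, add_zero] at hlt
  have hd' : -d = 1 ∨ -d = -1 := by omega
  have hfirst := slope_mono (hg j) hd' (p := x j) (q := w j + d)
    (by rcases hd with rfl | rfl <;> linarith)
  rw [add_neg_cancel_right] at hfirst
  obtain ⟨⟨i, a⟩, hia, himin⟩ := Finset.exists_min_image
    ((Finset.univ ×ˢ {1, -1} : Finset (Fin n × ℤ)).filter fun p => 0 < p.2 * (w p.1 - x p.1))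
    (fun p => g p.1 (x p.1 + p.2) - g p.1 (x p.1))
    ⟨(j, -d), by
      simp only [Finset.mem_filter, Finset.mem_product, Finset.mem_univ, Finset.mem_insert,
        Finset.mem_singleton, true_and]
      exact ⟨hd', by linarith⟩⟩
  simp only [Finset.mem_filter, Finset.mem_product, Finset.mem_univ, Finset.mem_insert,
    Finset.mem_singleton, true_and, Prod.forall] at hia himin
  have hi := himin j (-d) ⟨hd', by linarith⟩
  have hdesc := exists_descent_of_steepest hJ hg hf hxJ hwJ hnear hia.1 hia.2 (by linarith)
    fun j d hd h => himin j d ⟨hd, h⟩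
  have := hsmin _ (single_mem_unitVec i hia.1) hdesc
  rw [hstep, hstep] at this
  linarith

theorem stmt3 {n : ℕ} (J : Set (Fin n → ℤ)) (f : (Fin n → ℤ) → ℝ)
    (x sstar : Fin n → ℤ)
    (hn : 2 ≤ n) (hJ : IsJumpSystem J) (hJfin : J.Finite) (hf : IsSepConvex f)
    (hxJ : x ∈ J) (hxopt : ¬ IsOptimal J f x)
    (hs : DescentS J f x sstar) :
    ∃ y ∈ Mstar J f x, ∀ i : Fin n,
      (sstar = -Pi.single i 1 → y i ≤ x i - 1) ∧
      (sstar = Pi.single i 1 → x i + 1 ≤ y i) := by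
  obtain ⟨h, e, he, rfl⟩ := mem_unitVec_iff.1 hs.1
  obtain ⟨y, hy, hlt⟩ := exists_mem_Mstar_of_descentS hJ hJfin hf hxJ he hs
  refine ⟨y, hy, fun i => ⟨fun hi => ?_, fun hi => ?_⟩⟩ <;>
  · have hh := congrFun hi h
    simp only [Pi.neg_apply, Pi.single_apply, if_true] at hh
    split_ifs at hh with hhi
    · subst hhi hh
      omega
    · omega
end

section
/- Let J ⊆ ℤ^n be a jump system and f a separable convex function. Let x ∈ J be a vector that is not an optimal solution of (JSC), and let s* ∈ U satisfy (descent-s) at x. Then f(x + s*) < f(x). -/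
open scoped BigOperators

theorem UnitVec.apply_cases {n : ℕ} {s t : Fin n → ℤ} (hs : s ∈ UnitVec n) (ht : t ∈ UnitVec n)
    (hne : t ≠ -s) (i : Fin n) :
    s i = 0 ∨ t i = 0 ∨ (s i = 1 ∧ t i = 1) ∨ (s i = -1 ∧ t i = -1) := by
  obtain ⟨j, hj⟩ := hs
  obtain ⟨k, hk⟩ := ht
  by_cases hij : i = j
  · by_cases hik : i = k
    · subst hij hik
      rcases hj with rfl | rfl <;> rcases hk with rfl | rfl <;> simp_all
    · rcases hk with rfl | rfl <;> simp [hik]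
  · rcases hj with rfl | rfl <;> simp [hij]

theorem IsSepConvex.add_le_add_of_ne_neg {n : ℕ} {f : (Fin n → ℤ) → ℝ} (hf : IsSepConvex f)
    (x : Fin n → ℤ) {s t : Fin n → ℤ} (hs : s ∈ UnitVec n) (ht : t ∈ UnitVec n) (hne : t ≠ -s) :
    f (x + s) + f (x + t) ≤ f x + f (x + s + t) := by
  obtain ⟨g, hg, hfg⟩ := hf
  simp only [hfg, ← Finset.sum_add_distrib, Pi.add_apply]
  refine Finset.sum_le_sum fun i _ => ?_
  rcases UnitVec.apply_cases hs ht hne i with h | h | ⟨h₁, h₂⟩ | ⟨h₁, h₂⟩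
  · simp [h]
  · simp [h, add_comm]
  · have := hg i (x i + 1)
    rw [add_sub_cancel_right] at this
    rw [h₁, h₂]
    linarith
  · have := hg i (x i + -1)
    rw [neg_add_cancel_right, sub_eq_add_neg] at this
    rw [h₁, h₂]
    linarith

theorem stmt9 {n : ℕ} (J : Set (Fin n → ℤ)) (f : (Fin n → ℤ) → ℝ)
    (x sstar : Fin n → ℤ)
    (hn : 2 ≤ n) (hJ : IsJumpSystem J) (hf : IsSepConvex f)
    (hxJ : x ∈ J) (hxopt : ¬ IsOptimal J f x)
    (hs : DescentS J f x sstar) :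
    f (x + sstar) < f x := by
  obtain ⟨hsU, ⟨t, ht, htJ, hlt⟩, hmin⟩ := hs
  rcases ht with ht | rfl
  · by_cases hne : t = -sstar
    · simp [hne] at hlt
    · have hsub := hf.add_le_add_of_ne_neg x hsU ht hne
      have hle := hmin t ht ⟨sstar, Or.inl hsU, by rwa [add_right_comm], by rwa [add_right_comm]⟩
      linarith
  · simpa using hlt
end

section
/- In the setting of the context (jump system J, separable convex f, vectors x, s*, t* = −χ_h, x*, the greedy sequence x_0,…,x_k with unit vectors s_j, t_j, the index l, and cases (CS), (CT)): f(x+s*+t*) − f(x+s*) = f(x_{l−1}) − f(x_{l−1}+s_l) if case (CS) holds, and f(x+s*+t*) − f(x+s*) = f(x_{l−1}+s_l) − f(x_{l−1}+s_l+t_l) if case (CT) holds. -/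
open scoped BigOperators

/-- The change of a separable convex function along `χ_h` depends only on the `h`-th coordinate. -/
theorem IsSepConvex.add_single_sub_eq {n : ℕ} {f : (Fin n → ℤ) → ℝ} (hf : IsSepConvex f)
    {u v : Fin n → ℤ} {h : Fin n} (huv : u h = v h) :
    f (u + Pi.single h 1) - f u = f (v + Pi.single h 1) - f v := by
  obtain ⟨g, -, hg⟩ := hf
  have key (w : Fin n → ℤ) :
      f (w + Pi.single h 1) - f w = g h (w h + 1) - g h (w h) := by
    rw [hg, hg, ← Finset.sum_sub_distrib, Finset.sum_eq_single h]
    · simp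
    · intro i _ hi
      simp [hi]
    · simp
  rw [key, key, huv]

theorem stmt11 {n : ℕ} (J : Set (Fin n → ℤ)) (f : (Fin n → ℤ) → ℝ)
    (x sstar tstar xstar : Fin n → ℤ) (h : Fin n)
    (k l : ℕ) (xs ss ts : ℕ → Fin n → ℤ)
    (hn : 2 ≤ n) (hJ : IsJumpSystem J) (hJfin : J.Finite) (hf : IsSepConvex f)
    (hxJ : x ∈ J) (hxopt : ¬ IsOptimal J f x)
    (hall : ∀ y, IsOptimal J f y → y ∈ Mstar J f x)
    (hs : DescentS J f x sstar) (hxs : x + sstar ∉ J)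
    (htd : tstar = -Pi.single h 1) (ht : DescentT J f x sstar tstar)
    (htnot : ∀ x' ∈ Mstar J f x, sstar ∈ inc x x' → tstar ∉ inc (x + sstar) x')
    (hx1 : xstar ∈ Mstar J f x) (hx2 : sstar ∈ inc x xstar)
    (hx3 : ∀ x' ∈ Mstar J f x, sstar ∈ inc x x' → xstar h ≤ x' h)
    (hk : 1 ≤ k)
    (hxs0 : xs 0 = x + sstar + tstar) (hxsk : xs k = xstar)
    (hseq : ∀ j, 1 ≤ j → j ≤ k →
      xs j ∈ J ∧ ss j ∈ UnitVec n ∧ (ts j ∈ UnitVec n ∨ ts j = 0) ∧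
      xs j = xs (j - 1) + ss j + ts j ∧
      ss j ∈ inc (xs (j - 1)) xstar ∧
      (∃ t, (t ∈ inc (xs (j - 1) + ss j) xstar ∨ t = 0) ∧
        xs (j - 1) + ss j + t ∈ J ∧ f (xs (j - 1) + ss j + t) < f (xs (j - 1))) ∧
      (∀ s ∈ inc (xs (j - 1)) xstar,
        (∃ t, (t ∈ inc (xs (j - 1) + s) xstar ∨ t = 0) ∧
          xs (j - 1) + s + t ∈ J ∧ f (xs (j - 1) + s + t) < f (xs (j - 1))) →
        f (xs (j - 1) + ss j) ≤ f (xs (j - 1) + s)) ∧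
      (xs (j - 1) + ss j ∈ J → ts j = 0) ∧
      (xs (j - 1) + ss j ∉ J →
        ts j ∈ inc (xs (j - 1) + ss j) xstar ∧
        f (xs (j - 1) + ss j + ts j) < f (xs (j - 1)) ∧
        ∀ t ∈ inc (xs (j - 1) + ss j) xstar,
          xs (j - 1) + ss j + t ∈ J → f (xs (j - 1) + ss j + t) < f (xs (j - 1)) →
          f (xs (j - 1) + ss j + ts j) ≤ f (xs (j - 1) + ss j + t)) ∧
      (∃ i, (ss j = Pi.single i 1 ∧ xs 0 i < xstar i) ∨
            (ss j = -Pi.single i 1 ∧ xstar i < xs 0 i)) ∧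
      (ts j = 0 ∨ ∃ i, (ts j = Pi.single i 1 ∧ xs 0 i < xstar i) ∨
            (ts j = -Pi.single i 1 ∧ xstar i < xs 0 i)))
    (hmono : ∀ j, 1 ≤ j → j + 1 ≤ k →
      f (xs (j - 1) + ss j) - f (xs (j - 1)) ≤ f (xs j + ss (j + 1)) - f (xs j))
    (hl1 : 1 ≤ l) (hl2 : l ≤ k) (hl3 : x h + sstar h ≤ xs l h)
    (hl4 : ∀ l', 1 ≤ l' → l' < l → xs l' h < x h + sstar h)
    (hcase : (CScase x sstar h xs ss l ∧ ¬ CTcase x sstar h xs ss ts l) ∨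
             (CTcase x sstar h xs ss ts l ∧ ¬ CScase x sstar h xs ss l))
    :
    (CScase x sstar h xs ss l →
      f (x + sstar + tstar) - f (x + sstar) = f (xs (l - 1)) - f (xs (l - 1) + ss l)) ∧
    (CTcase x sstar h xs ss ts l →
      f (x + sstar + tstar) - f (x + sstar) =
        f (xs (l - 1) + ss l) - f (xs (l - 1) + ss l + ts l)) := by
  have hback : x + sstar + tstar + Pi.single h 1 = x + sstar := by
    rw [htd, neg_add_cancel_right]
  have hh : (x + sstar + tstar) h = x h + sstar h - 1 := by
    simp [htd, sub_eq_add_neg]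
  refine ⟨fun ⟨hval, hsl⟩ => ?_, fun ⟨hval, htl⟩ => ?_⟩
  · have hcoord : (x + sstar + tstar) h = xs (l - 1) h := by
      rw [hsl, Pi.single_eq_same] at hval
      omega
    have hstep := hf.add_single_sub_eq hcoord
    rw [hback] at hstep
    rw [hsl]
    linarith
  · have hcoord : (x + sstar + tstar) h = (xs (l - 1) + ss l) h := by
      rw [hh, Pi.add_apply, hval]
    have hstep := hf.add_single_sub_eq hcoord
    rw [hback] at hstep
    rw [htl]
    linarith
end

section
/- In the setting of the context (jump system J, separable convex f, vectors x, s*, t* = −χ_h, x*, the greedy sequence x_0,…,x_k, the index l, cases (CS), (CT), and sets T_0, T_−, T_+): (i) if case (CT) holds, then T_0, T_−, and T_+ are all contained in {1,…,l−1}; (ii) if case (CS) holds, then l ∈ T_0 ∪ T_−. -/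
open scoped BigOperators

/-- The increment of a separable function along a coordinate direction depends only on
the coordinate of the base point in that direction. -/
theorem IsSepConvex.sub_eq_sub_of_apply_eq {n : ℕ} {f : (Fin n → ℤ) → ℝ} (hf : IsSepConvex f)
    {u v : Fin n → ℤ} {i : Fin n} (c : ℤ) (huv : u i = v i) :
    f (u + Pi.single i c) - f u = f (v + Pi.single i c) - f v := by
  obtain ⟨g, -, hg⟩ := hf
  simp only [hg, ← Finset.sum_sub_distrib]
  refine Finset.sum_congr rfl fun j _ => ?_
  by_cases hj : j = i
  · subst hj
    simp [huv]
  · simp [hj]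

theorem stmt12 {n : ℕ} (J : Set (Fin n → ℤ)) (f : (Fin n → ℤ) → ℝ)
    (x sstar tstar xstar : Fin n → ℤ) (h : Fin n)
    (k l : ℕ) (xs ss ts : ℕ → Fin n → ℤ)
    (hn : 2 ≤ n) (hJ : IsJumpSystem J) (hJfin : J.Finite) (hf : IsSepConvex f)
    (hxJ : x ∈ J) (hxopt : ¬ IsOptimal J f x)
    (hall : ∀ y, IsOptimal J f y → y ∈ Mstar J f x)
    (hs : DescentS J f x sstar) (hxs : x + sstar ∉ J)
    (htd : tstar = -Pi.single h 1) (ht : DescentT J f x sstar tstar)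
    (htnot : ∀ x' ∈ Mstar J f x, sstar ∈ inc x x' → tstar ∉ inc (x + sstar) x')
    (hx1 : xstar ∈ Mstar J f x) (hx2 : sstar ∈ inc x xstar)
    (hx3 : ∀ x' ∈ Mstar J f x, sstar ∈ inc x x' → xstar h ≤ x' h)
    (hk : 1 ≤ k)
    (hxs0 : xs 0 = x + sstar + tstar) (hxsk : xs k = xstar)
    (hseq : ∀ j, 1 ≤ j → j ≤ k →
      xs j ∈ J ∧ ss j ∈ UnitVec n ∧ (ts j ∈ UnitVec n ∨ ts j = 0) ∧
      xs j = xs (j - 1) + ss j + ts j ∧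
      ss j ∈ inc (xs (j - 1)) xstar ∧
      (∃ t, (t ∈ inc (xs (j - 1) + ss j) xstar ∨ t = 0) ∧
        xs (j - 1) + ss j + t ∈ J ∧ f (xs (j - 1) + ss j + t) < f (xs (j - 1))) ∧
      (∀ s ∈ inc (xs (j - 1)) xstar,
        (∃ t, (t ∈ inc (xs (j - 1) + s) xstar ∨ t = 0) ∧
          xs (j - 1) + s + t ∈ J ∧ f (xs (j - 1) + s + t) < f (xs (j - 1))) →
        f (xs (j - 1) + ss j) ≤ f (xs (j - 1) + s)) ∧
      (xs (j - 1) + ss j ∈ J → ts j = 0) ∧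
      (xs (j - 1) + ss j ∉ J →
        ts j ∈ inc (xs (j - 1) + ss j) xstar ∧
        f (xs (j - 1) + ss j + ts j) < f (xs (j - 1)) ∧
        ∀ t ∈ inc (xs (j - 1) + ss j) xstar,
          xs (j - 1) + ss j + t ∈ J → f (xs (j - 1) + ss j + t) < f (xs (j - 1)) →
          f (xs (j - 1) + ss j + ts j) ≤ f (xs (j - 1) + ss j + t)) ∧
      (∃ i, (ss j = Pi.single i 1 ∧ xs 0 i < xstar i) ∨
            (ss j = -Pi.single i 1 ∧ xstar i < xs 0 i)) ∧
      (ts j = 0 ∨ ∃ i, (ts j = Pi.single i 1 ∧ xs 0 i < xstar i) ∨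
            (ts j = -Pi.single i 1 ∧ xstar i < xs 0 i)))
    (hmono : ∀ j, 1 ≤ j → j + 1 ≤ k →
      f (xs (j - 1) + ss j) - f (xs (j - 1)) ≤ f (xs j + ss (j + 1)) - f (xs j))
    (hl1 : 1 ≤ l) (hl2 : l ≤ k) (hl3 : x h + sstar h ≤ xs l h)
    (hl4 : ∀ l', 1 ≤ l' → l' < l → xs l' h < x h + sstar h)
    (hcase : (CScase x sstar h xs ss l ∧ ¬ CTcase x sstar h xs ss ts l) ∨
             (CTcase x sstar h xs ss ts l ∧ ¬ CScase x sstar h xs ss l))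
    (S T T0 Tm Tp : Finset ℕ)
    (hS : (CScase x sstar h xs ss l → S = Finset.Icc 1 (l - 1)) ∧
          (CTcase x sstar h xs ss ts l → S = Finset.Icc 1 l))
    (hT : (CScase x sstar h xs ss l → T = Finset.Icc 1 l) ∧
          (CTcase x sstar h xs ss ts l → T = Finset.Icc 1 (l - 1)))
    (hT0 : ∀ j, j ∈ T0 ↔ j ∈ T ∧ ts j = 0)
    (hTm : ∀ j, j ∈ Tm ↔ j ∈ T ∧ ts j ≠ 0 ∧
      f (xs (j - 1) + ss j + ts j) - f (xs (j - 1) + ss j) <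
        f (x + sstar + tstar) - f (x + sstar))
    (hTp : ∀ j, j ∈ Tp ↔ j ∈ T ∧ j ∉ T0 ∧ j ∉ Tm)
    :
    (CTcase x sstar h xs ss ts l →
      (∀ j ∈ T0, j ≤ l - 1) ∧ (∀ j ∈ Tm, j ≤ l - 1) ∧ (∀ j ∈ Tp, j ≤ l - 1)) ∧
    (CScase x sstar h xs ss l → l ∈ T0 ∪ Tm) := by
  refine ⟨fun hCT => ?_, fun hCS => ?_⟩
  · have hTl : ∀ j ∈ T, j ≤ l - 1 := fun j hj => by
      rw [hT.2 hCT] at hj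
      exact (Finset.mem_Icc.mp hj).2
    exact ⟨fun j hj => hTl j ((hT0 j).mp hj).1, fun j hj => hTl j ((hTm j).mp hj).1,
      fun j hj => hTl j ((hTp j).mp hj).1⟩
  · have hlT : l ∈ T := by
      rw [hT.1 hCS]
      exact Finset.mem_Icc.mpr ⟨hl1, le_rfl⟩
    obtain ⟨hcoord, hsl⟩ := hCS
    rw [Finset.mem_union, hT0, hTm]
    by_cases htl : ts l = 0
    · exact Or.inl ⟨hlT, htl⟩
    · refine Or.inr ⟨hlT, htl, ?_⟩
      obtain ⟨-, -, -, -, -, -, -, hmem, hnmem, -⟩ := hseq l hl1 hl2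
      have hdesc := (hnmem fun hJl => htl (hmem hJl)).2.1
      have hbase : xs (l - 1) h = (x + sstar + tstar) h := by
        simp only [hsl, Pi.single_eq_same] at hcoord
        simp only [htd, Pi.add_apply, Pi.neg_apply, Pi.single_eq_same]
        omega
      have hstep := hf.sub_eq_sub_of_apply_eq 1 hbase
      have hcancel : x + sstar + tstar + Pi.single h 1 = x + sstar := by
        rw [htd, neg_add_cancel_right]
      rw [hcancel, ← hsl] at hstep
      linarith
end
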